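/- arXiv:2410.13105 — 5 statements merged into one kernel-verified Lean document; each statement's English description precedes it below -/
import Mathlib

section
/- Let Z be a standard Gaussian random variable, μ ∈ ℝ, σ > 0, and set P = exp(μ + σZ) (the one-step collateral price ratio p_{t+1}/p_t). Let LT ∈ (0,1) be the liquidation threshold, and let a borrower have debt B > 0 and collateral C > 0 with current price p_t > 0 satisfying B/(C·p_t) ≤ LT. Then the expected default E[max{0, B − C·p_t·P}] satisfies E[max{0, B − C·p_t·P}] ≤ B·( Φ((ln LT − μ)/σ) − (exp(σ²/2 + μ)/LT)·Φ((ln LT − μ − σ²)/σ) ), where Φ denotes the standard normal cumulative distribution function. -/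
open MeasureTheory ProbabilityTheory Real

/-- The standard normal cumulative distribution function. -/
noncomputable def stdNormalCDF (x : ℝ) : ℝ :=
  (gaussianReal 0 1 (Set.Iic x)).toReal

/-- The partial exponential moment of the standard normal law on a lower half-line. -/
lemma setIntegral_Iic_exp_mul_gaussianReal (t a : ℝ) :
    ∫ z in Set.Iic a, Real.exp (t * z) ∂(gaussianReal 0 1) =
      Real.exp (t ^ 2 / 2) * stdNormalCDF (a - t) := by
  have hshift : gaussianReal 0 1 (Set.Iic (a - t)) = gaussianReal t 1 (Set.Iic a) := by
    have hmap := gaussianReal_map_add_const (μ := 0) (v := 1) t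
    rw [zero_add] at hmap
    rw [← hmap, Measure.map_apply (by fun_prop) measurableSet_Iic]
    congr 1
    ext z
    simp [le_sub_iff_add_le]
  have hpdf (z : ℝ) : gaussianPDFReal 0 1 z * Real.exp (t * z) =
      Real.exp (t ^ 2 / 2) * gaussianPDFReal t 1 z := by
    simp only [gaussianPDFReal]
    rw [mul_assoc, ← Real.exp_add, mul_left_comm, ← Real.exp_add]
    congr 2
    push_cast
    ring
  rw [stdNormalCDF, hshift, gaussianReal_apply_eq_integral _ one_ne_zero,
    ENNReal.toReal_ofReal (integral_nonneg fun z => gaussianPDFReal_nonneg _ _ _),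
    ← integral_const_mul, ← integral_indicator measurableSet_Iic,
    integral_gaussianReal_eq_integral_smul one_ne_zero,
    ← integral_indicator measurableSet_Iic]
  congr 1
  ext z
  by_cases hz : z ∈ Set.Iic a
  · simp only [Set.indicator_of_mem hz, smul_eq_mul, hpdf]
  · simp only [Set.indicator_of_notMem hz, smul_zero]

/-- The undiscounted price of a put option with strike `L` on a lognormal asset. -/
lemma integral_max_sub_exp_gaussianReal (μ : ℝ) {σ L : ℝ} (hσ : 0 < σ) (hL : 0 < L) :
    ∫ z, max 0 (L - Real.exp (μ + σ * z)) ∂(gaussianReal 0 1) =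
      L * stdNormalCDF ((Real.log L - μ) / σ) -
        Real.exp (σ ^ 2 / 2 + μ) * stdNormalCDF ((-μ + Real.log L - σ ^ 2) / σ) := by
  set a := (Real.log L - μ) / σ with ha
  have hmax (z : ℝ) : max 0 (L - Real.exp (μ + σ * z)) =
      (Set.Iic a).indicator (fun z => L - Real.exp μ * Real.exp (σ * z)) z := by
    have hiff : z ≤ a ↔ Real.exp (μ + σ * z) ≤ L := by
      rw [← Real.le_log_iff_exp_le hL, ha, le_div_iff₀ hσ, le_sub_iff_add_le, add_comm,
        mul_comm z]
    by_cases hz : z ≤ a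
    · rw [Set.indicator_of_mem (Set.mem_Iic.2 hz), ← Real.exp_add,
        max_eq_right (sub_nonneg.2 (hiff.1 hz))]
    · rw [Set.indicator_of_notMem (by simpa using hz)]
      exact max_eq_left (sub_nonpos.2 (not_le.1 (hiff.not.1 hz)).le)
  have hshift : (-μ + Real.log L - σ ^ 2) / σ = a - σ := by
    rw [ha]
    field_simp
    ring
  simp_rw [hmax]
  rw [integral_indicator measurableSet_Iic, integral_sub (integrable_const _)
      ((integrable_exp_mul_gaussianReal σ).const_mul _).integrableOn,
    integral_const_mul, setIntegral_Iic_exp_mul_gaussianReal, hshift, setIntegral_const,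
    Real.exp_add, smul_eq_mul, measureReal_def, stdNormalCDF, stdNormalCDF]
  ring

/-- Lemma 3.3 (default part): a bound on the expected default of a borrower with
debt `B`, collateral `C`, current price `p`, loan-to-value at most `LT`, when the
price ratio is lognormal `P = exp(μ + σZ)`. -/
theorem stmt_4 {Ω : Type*} [MeasurableSpace Ω] (P : Measure Ω) [IsProbabilityMeasure P]
    (Z : Ω → ℝ) (hZ : Measurable Z) (hlaw : P.map Z = gaussianReal 0 1)
    (μ σ : ℝ) (hσ : 0 < σ)
    (LT B C p : ℝ) (hLT : LT ∈ Set.Ioo (0 : ℝ) 1)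
    (hB : 0 < B) (hC : 0 < C) (hp : 0 < p)
    (hltv : B / (C * p) ≤ LT) :
    ∫ ω, max 0 (B - C * p * Real.exp (μ + σ * Z ω)) ∂P ≤
      B * (stdNormalCDF ((Real.log LT - μ) / σ)
        - Real.exp (σ ^ 2 / 2 + μ) / LT *
            stdNormalCDF ((-μ + Real.log LT - σ ^ 2) / σ)) := by
  obtain ⟨hLT, -⟩ := hLT
  have hCp : 0 < C * p := mul_pos hC hp
  have hBL : B / LT ≤ C * p := by
    rw [div_le_iff₀ hLT, mul_comm]
    exact (div_le_iff₀ hCp).1 hltv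
  have hpayoff (z : ℝ) : max 0 (B - C * p * Real.exp (μ + σ * z)) ≤
      B / LT * max 0 (LT - Real.exp (μ + σ * z)) := by
    rw [mul_max_of_nonneg _ _ (by positivity), mul_zero, mul_sub, div_mul_cancel₀ _ hLT.ne']
    gcongr
  have hint : Integrable (fun z => B / LT * max 0 (LT - Real.exp (μ + σ * z)))
      (gaussianReal 0 1) := by
    simp_rw [Real.exp_add]
    exact ((integrable_const (0 : ℝ)).sup ((integrable_const LT).sub
      ((integrable_exp_mul_gaussianReal σ).const_mul _))).const_mul _
  calc ∫ ω, max 0 (B - C * p * Real.exp (μ + σ * Z ω)) ∂P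
      = ∫ z, max 0 (B - C * p * Real.exp (μ + σ * z)) ∂(gaussianReal 0 1) := by
        rw [← hlaw, integral_map hZ.aemeasurable
          (by fun_prop)]
    _ ≤ ∫ z, B / LT * max 0 (LT - Real.exp (μ + σ * z)) ∂(gaussianReal 0 1) :=
        integral_mono_of_nonneg (ae_of_all _ fun z => le_max_left _ _) hint
          (ae_of_all _ hpayoff)
    _ = _ := by
        rw [integral_const_mul, integral_max_sub_exp_gaussianReal μ hσ hLT]
        field_simp
end

section
/- Let a, L, R₁, R₂ > 0, U* ∈ (0,1) and b ∈ ℝ. Define the optimal rate r* = (b − L·U*)/a, the mismatch Δ = |R₁ − r*|, and the two steady-state baseline rates r₁ = b·R₁/(U*·L + a·R₁) and r₂ = R₁ + R₂·(b − a·R₁ − U*·L)/((L + a·R₂/(1 − U*))·(1 − U*)). Then |r₁ − r*| = Δ/(1 + a·R₁/(L·U*)) and |r₂ − r*| = Δ/(1 + a·R₂/(L·(1 − U*))); consequently both |r₁ − r*| and |r₂ − r*| are ≥ Δ/(1 + (a/L)·max{R₁/U*, R₂/(1 − U*)}), and each of them equals 0 if and only if Δ = 0. -/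
/-- Theorem 3.2: the rate deviations of the two steady-state baseline rates from the
optimal rate `r* = (b − L·U*)/a` equal `Δ/(1 + a·R₁/(L·U*))` and
`Δ/(1 + a·R₂/(L·(1 − U*)))`, hence are bounded below by
`Δ/(1 + (a/L)·max{R₁/U*, R₂/(1 − U*)})`, and vanish iff `Δ = 0`. -/
theorem stmt_8 (a L R₁ R₂ b Ustar : ℝ) (ha : 0 < a) (hL : 0 < L)
    (hR₁ : 0 < R₁) (hR₂ : 0 < R₂) (hUstar : Ustar ∈ Set.Ioo (0 : ℝ) 1) :
    let rstar := (b - L * Ustar) / a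
    let Δ := |R₁ - rstar|
    let r₁ := b * R₁ / (Ustar * L + a * R₁)
    let r₂ := R₁ + R₂ * (b - a * R₁ - Ustar * L) / ((L + a * R₂ / (1 - Ustar)) * (1 - Ustar))
    |r₁ - rstar| = Δ / (1 + a * R₁ / (L * Ustar)) ∧
    |r₂ - rstar| = Δ / (1 + a * R₂ / (L * (1 - Ustar))) ∧
    Δ / (1 + a / L * max (R₁ / Ustar) (R₂ / (1 - Ustar))) ≤ |r₁ - rstar| ∧
    Δ / (1 + a / L * max (R₁ / Ustar) (R₂ / (1 - Ustar))) ≤ |r₂ - rstar| ∧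
    (|r₁ - rstar| = 0 ↔ Δ = 0) ∧
    (|r₂ - rstar| = 0 ↔ Δ = 0) := by
  obtain ⟨hU, hU1⟩ := hUstar
  have hV : 0 < 1 - Ustar := sub_pos.2 hU1
  intro rstar Δ r₁ r₂
  have hc₁ : 0 < 1 + a * R₁ / (L * Ustar) := by positivity
  have hc₂ : 0 < 1 + a * R₂ / (L * (1 - Ustar)) := by positivity
  have h₁ : |r₁ - rstar| = Δ / (1 + a * R₁ / (L * Ustar)) := by
    have h : r₁ - rstar = (R₁ - rstar) / (1 + a * R₁ / (L * Ustar)) := by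
      have hD : Ustar * L + a * R₁ ≠ 0 := by positivity
      rw [eq_div_iff hc₁.ne']
      simp only [r₁, rstar]
      field_simp
      ring
    rw [h, abs_div, abs_of_pos hc₁]
  have h₂ : |r₂ - rstar| = Δ / (1 + a * R₂ / (L * (1 - Ustar))) := by
    have h : r₂ - rstar = (R₁ - rstar) / (1 + a * R₂ / (L * (1 - Ustar))) := by
      have hE : (L + a * R₂ / (1 - Ustar)) * (1 - Ustar) = L * (1 - Ustar) + a * R₂ := by
        field_simp
      have hE0 : L * (1 - Ustar) + a * R₂ ≠ 0 := by positivity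
      rw [eq_div_iff hc₂.ne']
      simp only [r₂, rstar, hE]
      field_simp
      ring
    rw [h, abs_div, abs_of_pos hc₂]
  refine ⟨h₁, h₂, ?_, ?_, ?_, ?_⟩
  · rw [← div_mul_div_comm] at h₁ hc₁
    rw [h₁]
    gcongr
    exact le_max_left _ _
  · rw [← div_mul_div_comm] at h₂ hc₂
    rw [h₂]
    gcongr
    exact le_max_right _ _
  · rw [h₁, div_eq_zero_iff, or_iff_left hc₁.ne']
  · rw [h₂, div_eq_zero_iff, or_iff_left hc₂.ne']
end

section
/- Let a, L > 0, U* ∈ (0,1), δ ∈ (0,1) and b ∈ ℝ. (i) For every r̄ ∈ ℝ: (b − a·r̄)/(L·(1 − δ)) − U* > U* − (b − a·r̄)/L if and only if r̄ < (b − U*·L·(1 − δ)/(1 − δ/2))/a. (ii) If r* = (b − L·U*)/a and r̄ satisfies r̄ < (b − U*·L·(1 − δ)/(1 − δ/2))/a together with r̄ ≥ r*, then r̄ − r* < U*·L·δ/(a·(2 − δ)). -/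
/-- Strategic-lender case of Theorem 4.2: (i) the controller adopts the over-reported
lender rate `r̄` iff `r̄ < (b − U*·L·(1 − δ)/(1 − δ/2))/a`; (ii) any such adopted rate
at least the truthful optimum `r* = (b − L·U*)/a` exceeds it by less than
`U*·L·δ/(a·(2 − δ))`. -/
theorem stmt_12 (a L b Ustar δ : ℝ) (ha : 0 < a) (hL : 0 < L)
    (hUstar : Ustar ∈ Set.Ioo (0 : ℝ) 1) (hδ : δ ∈ Set.Ioo (0 : ℝ) 1) :
    (∀ rbar : ℝ,
      (b - a * rbar) / (L * (1 - δ)) - Ustar > Ustar - (b - a * rbar) / L ↔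
      rbar < (b - Ustar * L * (1 - δ) / (1 - δ / 2)) / a) ∧
    (∀ rbar : ℝ,
      rbar < (b - Ustar * L * (1 - δ) / (1 - δ / 2)) / a →
      (b - L * Ustar) / a ≤ rbar →
      rbar - (b - L * Ustar) / a < Ustar * L * δ / (a * (2 - δ))) := by
  obtain ⟨_, hδ1⟩ := hδ
  have h1 : 0 < 1 - δ := by linarith
  have h2 : 0 < 2 - δ := by linarith
  have h3 : 1 - δ / 2 = (2 - δ) / 2 := by ring
  rw [h3]
  refine ⟨fun rbar => ?_, fun rbar hr _ => ?_⟩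
  · have key : (b - a * rbar) / (L * (1 - δ)) - Ustar - (Ustar - (b - a * rbar) / L) =
        a * (2 - δ) / (L * (1 - δ)) *
          ((b - Ustar * L * (1 - δ) / ((2 - δ) / 2)) / a - rbar) := by
      field_simp
      ring
    have hc : 0 < a * (2 - δ) / (L * (1 - δ)) := by positivity
    rw [gt_iff_lt, ← sub_pos, key, mul_pos_iff_of_pos_left hc, sub_pos]
  · have key : (b - Ustar * L * (1 - δ) / ((2 - δ) / 2)) / a - (b - L * Ustar) / a =
        Ustar * L * δ / (a * (2 - δ)) := by
      field_simp
      ring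
    linarith
end

section
/- Let B, L, α > 0, δ ∈ (0,1), β ∈ ℝ and r^l > β. Set M = L·(1 − δ) and D = δ·L, and define h(x) = x·(α·B/(M + x) + β) + (D − x)·r^l for x ∈ (−M, ∞). Then h is strictly concave on (−M, ∞), and x* = −M + √(α·B·M/(r^l − β)) is its unique critical point and its unique global maximizer on (−M, ∞). -/
/-- The reciprocal satisfies the strict Jensen inequality on positive reals. -/
theorem inv_convexCombination_lt {a b u v : ℝ} (ha : 0 < a) (hb : 0 < b) (hab : a + b = 1)
    (hu : 0 < u) (hv : 0 < v) (huv : u ≠ v) : (a * u + b * v)⁻¹ < a * u⁻¹ + b * v⁻¹ := by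
  have hw : 0 < a * u + b * v := by positivity
  have hsq : 0 < (u - v) ^ 2 := by
    have := sub_ne_zero.mpr huv
    positivity
  have hpos : 0 < a * b * (u - v) ^ 2 / (u * v * (a * u + b * v)) := by positivity
  have key : a * u⁻¹ + b * v⁻¹ - (a * u + b * v)⁻¹
      = a * b * (u - v) ^ 2 / (u * v * (a * u + b * v)) := by
    obtain rfl : b = 1 - a := by linarith
    field_simp
    ring
  linarith

/-- Optimal strategic-withholding deposit (proof of Theorem 4.3): the strategic
lender's utility `h(x) = x·(αB/(M + x) + β) + (D − x)·r^l` is strictly concave on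
`(−M, ∞)`, and `x* = −M + √(αBM/(r^l − β))` is its unique critical point and unique
global maximizer there. -/
theorem stmt_13 (B L α δ β rl : ℝ) (hB : 0 < B) (hL : 0 < L) (hα : 0 < α)
    (hδ : δ ∈ Set.Ioo (0 : ℝ) 1) (hrl : β < rl) :
    let M := L * (1 - δ)
    let D := δ * L
    let h : ℝ → ℝ := fun x => x * (α * B / (M + x) + β) + (D - x) * rl
    let xstar := -M + Real.sqrt (α * B * M / (rl - β))
    StrictConcaveOn ℝ (Set.Ioi (-M)) h ∧
    xstar ∈ Set.Ioi (-M) ∧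
    deriv h xstar = 0 ∧
    (∀ x ∈ Set.Ioi (-M), deriv h x = 0 → x = xstar) ∧
    (∀ x ∈ Set.Ioi (-M), x ≠ xstar → h x < h xstar) := by
  intro M D h xstar
  have hM : 0 < M := mul_pos hL (sub_pos.mpr hδ.2)
  have hc : 0 < rl - β := sub_pos.mpr hrl
  obtain ⟨s, hs⟩ : ∃ s, s = Real.sqrt (α * B * M / (rl - β)) := ⟨_, rfl⟩
  have hs0 : 0 < s := hs ▸ Real.sqrt_pos.mpr (by positivity)
  have hs2 : α * B * M = (rl - β) * s ^ 2 := by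
    rw [hs, Real.sq_sqrt (by positivity)]
    field_simp
  have hxs : xstar = -M + s := by rw [hs]
  have hxmem : xstar ∈ Set.Ioi (-M) := by
    rw [hxs, Set.mem_Ioi]
    linarith
  have hform : ∀ x ∈ Set.Ioi (-M),
      h x = α * B + D * rl - (rl - β) * x - α * B * M * (M + x)⁻¹ := by
    intro x hx
    have hy : M + x ≠ 0 := by
      rw [Set.mem_Ioi] at hx
      linarith
    simp only [h]
    field_simp
    ring
  have hderiv : ∀ x ∈ Set.Ioi (-M), deriv h x = (rl - β) * (s ^ 2 / (M + x) ^ 2 - 1) := by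
    intro x hx
    have hy : M + x ≠ 0 := by
      rw [Set.mem_Ioi] at hx
      linarith
    have hd := (((hasDerivAt_id x).const_mul (rl - β)).const_sub (α * B + D * rl)).sub
      ((((hasDerivAt_id x).const_add M).fun_inv hy).const_mul (α * B * M))
    have he := hd.congr_of_eventuallyEq
      (Filter.eventuallyEq_of_mem (Ioi_mem_nhds hx) hform)
    rw [he.deriv, hs2]
    simp only [id]
    ring
  refine ⟨⟨convex_Ioi _, ?_⟩, hxmem, ?_, ?_, ?_⟩
  · intro x hx y hy hxy a b ha hb hab
    have hz := convex_Ioi (-M) hx hy ha.le hb.le hab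
    rw [hform x hx, hform y hy, hform _ hz]
    rw [Set.mem_Ioi] at hx hy
    have hj := inv_convexCombination_lt ha hb hab (u := M + x) (v := M + y)
      (by linarith) (by linarith) (by simpa using hxy)
    have hsum : a * (M + x) + b * (M + y) = M + (a * x + b * y) := by
      linear_combination M * hab
    rw [hsum] at hj
    have hj' := mul_lt_mul_of_pos_left hj (show 0 < α * B * M by positivity)
    simp only [smul_eq_mul]
    linear_combination hj' + (α * B + D * rl) * hab
  · rw [hderiv _ hxmem, hxs, add_neg_cancel_left, div_self (by positivity), sub_self, mul_zero]
  · intro x hx hx0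
    rw [hderiv x hx] at hx0
    rw [Set.mem_Ioi] at hx
    have hy : 0 < M + x := by linarith
    have hdiv : s ^ 2 / (M + x) ^ 2 = 1 :=
      sub_eq_zero.mp ((mul_eq_zero.mp hx0).resolve_left hc.ne')
    have hsq : s ^ 2 = (M + x) ^ 2 := (div_eq_one_iff_eq (by positivity)).mp hdiv
    have := (pow_left_inj₀ hs0.le hy.le two_ne_zero).mp hsq
    linarith
  · intro x hx hne
    rw [hform x hx, hform _ hxmem, hs2]
    rw [Set.mem_Ioi] at hx
    have hy : 0 < M + x := by linarith
    have hsq : 0 < (x - xstar) ^ 2 := by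
      have := sub_ne_zero.mpr hne
      positivity
    have hpos : 0 < (rl - β) * (x - xstar) ^ 2 / (M + x) := by positivity
    have key : (rl - β) * (x - xstar) ^ 2 / (M + x)
        = (α * B + D * rl - (rl - β) * xstar - (rl - β) * s ^ 2 * (M + xstar)⁻¹)
          - (α * B + D * rl - (rl - β) * x - (rl - β) * s ^ 2 * (M + x)⁻¹) := by
      rw [hxs, add_neg_cancel_left]
      field_simp
      ring
    linarith
end

section
/- Let B, L > 0, δ ∈ (0,1), R₂ > 0, U* ∈ (0,1), and set α = R₂/(1 − U*). Suppose x_s, x_t ∈ [0, δ·L], and define U_s = B/(L·(1 − δ) + x_s) and U_t = B/(L·(1 − δ) + x_t). Then |α·U_s − α·U_t| ≤ B·δ·R₂/(L·(1 − δ)·(1 − U*)). -/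
/-- Utilization at fixed demand `B` lies between its values at full and at zero
strategic deposit. -/
theorem utilization_mem_Icc {B L δ x : ℝ} (hB : 0 < B) (hL : 0 < L) (hδ : δ < 1)
    (hx : x ∈ Set.Icc (0 : ℝ) (δ * L)) :
    B / (L * (1 - δ) + x) ∈ Set.Icc (B / L) (B / (L * (1 - δ))) := by
  obtain ⟨hx0, hx1⟩ := hx
  have hpos : 0 < L * (1 - δ) := mul_pos hL (sub_pos.mpr hδ)
  exact ⟨div_le_div_of_nonneg_left hB.le (by linarith) (by linarith),
    div_le_div_of_nonneg_left hB.le hpos (by linarith)⟩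

/-- Lender half of Theorem 4.3: with truthful supply `L(1 − δ)`, strategic and
truthful deposits `x_s, x_t ∈ [0, δL]` and fixed demand `B`, the adversarial impact
on the interest rate (slope `α = R₂/(1 − U*)` times the utilization gap) is at most
`B·δ·R₂/(L·(1 − δ)·(1 − U*))`. -/
theorem stmt_15 (B L δ R₂ Ustar xs xt : ℝ) (hB : 0 < B) (hL : 0 < L)
    (hδ : δ ∈ Set.Ioo (0 : ℝ) 1) (hR₂ : 0 < R₂) (hUstar : Ustar ∈ Set.Ioo (0 : ℝ) 1)
    (hxs : xs ∈ Set.Icc (0 : ℝ) (δ * L)) (hxt : xt ∈ Set.Icc (0 : ℝ) (δ * L)) :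
    let α := R₂ / (1 - Ustar)
    let Us := B / (L * (1 - δ) + xs)
    let Ut := B / (L * (1 - δ) + xt)
    |α * Us - α * Ut| ≤ B * δ * R₂ / (L * (1 - δ) * (1 - Ustar)) := by
  intro α Us Ut
  have hδ' : 0 < 1 - δ := sub_pos.mpr hδ.2
  have hU : 0 < 1 - Ustar := sub_pos.mpr hUstar.2
  have hα : 0 ≤ α := (div_pos hR₂ hU).le
  have hgap : |Us - Ut| ≤ B / (L * (1 - δ)) - B / L :=
    abs_sub_le_of_le_of_le (utilization_mem_Icc hB hL hδ.2 hxs).1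
      (utilization_mem_Icc hB hL hδ.2 hxs).2 (utilization_mem_Icc hB hL hδ.2 hxt).1
      (utilization_mem_Icc hB hL hδ.2 hxt).2
  calc |α * Us - α * Ut| = α * |Us - Ut| := by rw [← mul_sub, abs_mul, abs_of_nonneg hα]
    _ ≤ α * (B / (L * (1 - δ)) - B / L) := mul_le_mul_of_nonneg_left hgap hα
    _ = B * δ * R₂ / (L * (1 - δ) * (1 - Ustar)) := by
      simp only [α]
      field_simp
      ring
end
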